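/- arXiv:1006.0728 — 5 statements merged into one kernel-verified Lean document; each statement's English description precedes it below -/
import Mathlib

section
/- The kernel of the ring homomorphism φ equals the ideal product (c) · (h₃, c − h₂²) in ℚ[k, h₂, h₃, c]. (This is the computation of the kernel of the restriction of the product φ_ell × φ_W of the Ochanine elliptic genus and the Witten genus to ℚ[Kum, HP², HP³, CaP²].) -/
open MvPolynomial

noncomputable section

/-- `ℚ[k, h₂, h₃, c]`, with `k = X 0`, `h₂ = X 1`, `h₃ = X 2`, `c = X 3`
(the bordism classes of the Kummer surface, `HP²`, `HP³` and the Cayley plane `CaP²`). -/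
abbrev A : Type := MvPolynomial (Fin 4) ℚ

/-- `ℚ[δ, ε] × ℚ[g₂, g₄, g₆]`, with `δ = X 0`, `ε = X 1`, `g₂ = X 0`, `g₄ = X 1`, `g₆ = X 2`. -/
abbrev B : Type := MvPolynomial (Fin 2) ℚ × MvPolynomial (Fin 3) ℚ

/-- The product `φ = φ_ell × φ_W` of the Ochanine elliptic genus and the Witten genus,
restricted to `ℚ[Kum, HP², HP³, CaP²]`: `φ(k) = (16δ, 48g₂)`,
`φ(h₂) = (ε, 2g₂² − (5/6)g₄)`, `φ(h₃) = (0, −(4/9)g₂³ + (1/9)g₂g₄ + (7/1080)g₆)`,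
`φ(c) = (ε², 0)`. -/
def φ : A →ₐ[ℚ] B :=
  aeval
    ![(C 16 * X 0, C 48 * X 0),
      (X 1, C 2 * X 0 ^ 2 - C (5/6) * X 1),
      (0, -C (4/9) * X 0 ^ 3 + C (1/9) * X 0 * X 1 + C (7/1080) * X 2),
      ((X 1) ^ 2, 0)]

/-- If `s` inverts `f` on the variables modulo `I`, then the kernel of `f` lies in `I`. -/
theorem ker_le_of_section_mod {σ R S : Type*} [CommRing R] [CommRing S] [Algebra R S]
    (f : MvPolynomial σ R →ₐ[R] S) (s : S →ₐ[R] MvPolynomial σ R) (I : Ideal (MvPolynomial σ R))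
    (h : ∀ i, s (f (X i)) - X i ∈ I) : RingHom.ker f ≤ I := by
  have hcomp : ((Ideal.Quotient.mkₐ R I).comp s).comp f = Ideal.Quotient.mkₐ R I := by
    ext i
    exact Ideal.Quotient.eq.mpr (h i)
  intro p hp
  have hp' := DFunLike.congr_fun hcomp p
  rw [AlgHom.comp_apply, (RingHom.mem_ker).mp hp, map_zero] at hp'
  exact Ideal.Quotient.eq_zero_iff_mem.mp hp'.symm

/-- The elliptic genus component of `φ`. -/
def φEll : A →ₐ[ℚ] MvPolynomial (Fin 2) ℚ := (AlgHom.fst ℚ _ _).comp φ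

/-- The Witten genus component of `φ`. -/
def φWitten : A →ₐ[ℚ] MvPolynomial (Fin 3) ℚ := (AlgHom.snd ℚ _ _).comp φ

theorem ker_φEll : RingHom.ker φEll = Ideal.span {(X 2 : A), X 3 - (X 1) ^ 2} := by
  apply le_antisymm
  · apply ker_le_of_section_mod φEll (aeval ![C (1/16) * X 0, X 1])
    intro i
    fin_cases i
    · convert Ideal.zero_mem _
      simp [φEll, φ, ← mul_assoc, algebraMap_eq, ← C_mul]
    · simp [φEll, φ]
    · refine Ideal.mem_span_pair.mpr ⟨-1, 0, ?_⟩
      simp [φEll, φ]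
    · refine Ideal.mem_span_pair.mpr ⟨0, -1, ?_⟩
      simp [φEll, φ]
  · rw [Ideal.span_le]
    rintro p (rfl | rfl) <;> simp [φEll, φ]

theorem ker_φWitten : RingHom.ker φWitten = Ideal.span {(X 3 : A)} := by
  apply le_antisymm
  · let g₂ : A := C (1/48) * X 0
    let g₄ : A := C (6/5) * (C 2 * g₂ ^ 2 - X 1)
    let g₆ : A := C (1080/7) * (X 2 + C (4/9) * g₂ ^ 3 - C (1/9) * g₂ * g₄)
    have h₁ : (C 48 * C (1/48) : A) = 1 := by rw [← C_mul]; norm_num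
    have h₂ : (C (5/6) * C (6/5) : A) = 1 := by rw [← C_mul]; norm_num
    have h₃ : (C (7/1080) * C (1080/7) : A) = 1 := by rw [← C_mul]; norm_num
    apply ker_le_of_section_mod φWitten (aeval ![g₂, g₄, g₆])
    intro i
    fin_cases i
    · convert Ideal.zero_mem _
      simp only [φWitten, φ, AlgHom.comp_apply, aeval_X, AlgHom.snd_apply]
      simp only [Fin.zero_eta, Matrix.cons_val, map_mul, aeval_X, algHom_C, algebraMap_eq]
      linear_combination X 0 * h₁
    · convert Ideal.zero_mem _
      simp only [φWitten, φ, AlgHom.comp_apply, aeval_X, AlgHom.snd_apply]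
      simp only [Fin.mk_one, Matrix.cons_val, map_mul, map_sub, map_pow, aeval_X, algHom_C,
        algebraMap_eq]
      linear_combination -(C 2 * g₂ ^ 2 - X 1) * h₂
    · convert Ideal.zero_mem _
      simp only [φWitten, φ, AlgHom.comp_apply, aeval_X, AlgHom.snd_apply]
      simp only [Fin.reduceFinMk, Matrix.cons_val, map_mul, map_add, map_neg, map_pow, aeval_X,
        algHom_C, algebraMap_eq]
      linear_combination (X 2 + C (4/9) * g₂ ^ 3 - C (1/9) * g₂ * g₄) * h₃
    · rw [← neg_mem_iff]
      simp [φWitten, φ]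
  · rw [Ideal.span_le]
    rintro p rfl
    simp [φWitten, φ]

/-- The kernel of `φ = φ_ell × φ_W` on `ℚ[k, h₂, h₃, c]` is the ideal product
`(c) · (h₃, c − h₂²)`. -/
theorem stmt4 :
    RingHom.ker (φ : A →+* B) =
      Ideal.span {(X 3 : A)} * Ideal.span {(X 2 : A), X 3 - (X 1) ^ 2} := by
  rw [← ker_φWitten, ← ker_φEll]
  apply le_antisymm
  · intro p hp
    have hφ : φ p = 0 := hp
    have hW : p ∈ RingHom.ker φWitten := congrArg Prod.snd hφ
    have hE : φEll p = 0 := congrArg Prod.fst hφ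
    rw [ker_φWitten] at hW ⊢
    obtain ⟨q, rfl⟩ := Ideal.mem_span_singleton.mp hW
    refine Ideal.mul_mem_mul (Ideal.mem_span_singleton_self _) ?_
    have hc : φEll (X 3) = X 1 ^ 2 := by simp [φEll, φ]
    rw [map_mul, hc] at hE
    exact (mul_eq_zero.mp hE).resolve_left (pow_ne_zero 2 (X_ne_zero 1))
  · rw [Ideal.mul_le]
    intro r hr s hs
    have hr' : (φ r).2 = 0 := hr
    have hs' : (φ s).1 = 0 := hs
    change φ (r * s) = 0
    ext1 <;> simp [hr', hs']

end
end

section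
/- In the polynomial ring ℚ[k, h₂, h₃, c], the intersection of the principal ideal (c) with the ideal (h₃, c − h₂²) equals their product: (c) ∩ (h₃, c − h₂²) = (c) · (h₃, c − h₂²). -/
open MvPolynomial

/-- If `a` is a nonzerodivisor modulo `J`, then `(a) ∩ J = (a) · J`. -/
theorem Ideal.span_singleton_inf_eq_mul {R : Type*} [CommRing R] {a : R} {J : Ideal R}
    (h : ∀ g, a * g ∈ J → g ∈ J) : Ideal.span {a} ⊓ J = Ideal.span {a} * J := by
  refine le_antisymm ?_ Ideal.mul_le_inf
  rintro p ⟨hp, hpJ⟩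
  obtain ⟨g, rfl⟩ := Ideal.mem_span_singleton.mp hp
  exact Ideal.mul_mem_mul (Ideal.mem_span_singleton_self a) (h g hpJ)

/-- The substitution `h₃ ↦ 0`, `c ↦ h₂²`. -/
noncomputable def substHom : MvPolynomial (Fin 4) ℚ →ₐ[ℚ] MvPolynomial (Fin 4) ℚ :=
  aeval ![X 0, X 1, 0, X 1 ^ 2]

theorem mem_span_iff_substHom_eq_zero (p : MvPolynomial (Fin 4) ℚ) :
    p ∈ Ideal.span {(X 2 : MvPolynomial (Fin 4) ℚ), X 3 - (X 1) ^ 2} ↔ substHom p = 0 := by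
  set J := Ideal.span {(X 2 : MvPolynomial (Fin 4) ℚ), X 3 - (X 1) ^ 2} with hJ
  constructor
  · intro hp
    have hle : J ≤ RingHom.ker substHom := by
      rw [hJ, Ideal.span_le]
      rintro q (rfl | rfl) <;> simp [substHom, RingHom.mem_ker]
    exact hle hp
  · intro hp
    have hcomp : (Ideal.Quotient.mkₐ ℚ J).comp substHom = Ideal.Quotient.mkₐ ℚ J := by
      have h₃ : Ideal.Quotient.mk J (X 2) = 0 :=
        Ideal.Quotient.eq_zero_iff_mem.mpr (Ideal.subset_span (by simp))
      have hc : Ideal.Quotient.mk J (X 3) = Ideal.Quotient.mk J (X 1 ^ 2) :=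
        Ideal.Quotient.eq.mpr (Ideal.subset_span (by simp))
      ext i
      fin_cases i <;> simp [substHom, h₃, hc]
    have hmk := DFunLike.congr_fun hcomp p
    rw [AlgHom.comp_apply, hp, map_zero] at hmk
    exact Ideal.Quotient.eq_zero_iff_mem.mp hmk.symm

/-- In the polynomial ring `ℚ[k, h₂, h₃, c]` (with `k = X 0`, `h₂ = X 1`, `h₃ = X 2`,
`c = X 3`), the intersection of the principal ideal `(c)` with the ideal
`(h₃, c − h₂²)` equals their product: `(c) ∩ (h₃, c − h₂²) = (c) · (h₃, c − h₂²)`. -/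
theorem stmt5 :
    Ideal.span {(X 3 : MvPolynomial (Fin 4) ℚ)} ⊓
        Ideal.span {(X 2 : MvPolynomial (Fin 4) ℚ), X 3 - (X 1) ^ 2} =
      Ideal.span {(X 3 : MvPolynomial (Fin 4) ℚ)} *
        Ideal.span {(X 2 : MvPolynomial (Fin 4) ℚ), X 3 - (X 1) ^ 2} := by
  refine Ideal.span_singleton_inf_eq_mul fun g hg => ?_
  rw [mem_span_iff_substHom_eq_zero] at hg ⊢
  rw [map_mul] at hg
  have hc : substHom (X 3) ≠ 0 := by simp [substHom]
  exact (mul_eq_zero.mp hg).resolve_left hc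
end

section
/- The ring homomorphism φ_W : ℚ[k, h₂, h₃] → ℚ[g₂, g₄, g₆] is bijective, i.e. it is an isomorphism of ℚ-algebras. (This is the statement that the Witten genus restricts to an isomorphism from ℚ[Kum, HP², HP³] onto the ring of quasi-modular forms ℚ[G₂, G₄, G₆].) -/
open MvPolynomial

noncomputable section

/-- The Witten genus restricted to `ℚ[Kum, HP², HP³]`:
`φ_W : ℚ[k, h₂, h₃] → ℚ[g₂, g₄, g₆]` (with `k = X 0`, `h₂ = X 1`, `h₃ = X 2` on the
source and `g₂ = X 0`, `g₄ = X 1`, `g₆ = X 2` on the target) determined by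
`φ_W(k) = 48g₂`, `φ_W(h₂) = 2g₂² − (5/6)g₄`,
`φ_W(h₃) = −(4/9)g₂³ + (1/9)g₂g₄ + (7/1080)g₆`. -/
def φW : MvPolynomial (Fin 3) ℚ →ₐ[ℚ] MvPolynomial (Fin 3) ℚ :=
  aeval
    ![C 48 * X 0,
      C 2 * X 0 ^ 2 - C (5/6) * X 1,
      -C (4/9) * X 0 ^ 3 + C (1/9) * X 0 * X 1 + C (7/1080) * X 2]

/-- The inverse of `φW`, obtained by solving the triangular system for `g₂`, `g₄`, `g₆`. -/
def φWInv : MvPolynomial (Fin 3) ℚ →ₐ[ℚ] MvPolynomial (Fin 3) ℚ :=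
  aeval
    ![C (1/48) * X 0,
      C (1/960) * X 0 ^ 2 - C (6/5) * X 1,
      C (1/4032) * X 0 ^ 3 + C (3/7) * X 0 * X 1 + C (1080/7) * X 2]

theorem φWInv_comp_φW : φWInv.comp φW = AlgHom.id ℚ _ := by
  ext1 i
  refine MvPolynomial.funext fun x => ?_
  fin_cases i <;> simp [φW, φWInv, algHom_C, algebraMap_eq] <;> ring

theorem φW_comp_φWInv : φW.comp φWInv = AlgHom.id ℚ _ := by
  ext1 i
  refine MvPolynomial.funext fun x => ?_
  fin_cases i <;> simp [φW, φWInv, algHom_C, algebraMap_eq] <;> ring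

/-- `φ_W : ℚ[k, h₂, h₃] → ℚ[g₂, g₄, g₆]` is bijective, i.e. an isomorphism of
`ℚ`-algebras: the Witten genus restricts to an isomorphism from `ℚ[Kum, HP², HP³]`
onto the ring of quasi-modular forms `ℚ[G₂, G₄, G₆]`. -/
theorem stmt7 : Function.Bijective φW := by
  exact Function.bijective_iff_has_inverse.mpr
    ⟨φWInv, DFunLike.congr_fun φWInv_comp_φW, DFunLike.congr_fun φW_comp_φWInv⟩

end
end

section
/- There is no polynomial P ∈ ℚ[k, h₂, h₃, c] with φ(P) = (ε, 0). (This is the assertion that (ε, 0) is not in the image of the product genus φ_ell × φ_W, even though (ε², 0), the image of the Cayley plane, is; this is the 'synergy' between the elliptic genus and the Witten genus.) -/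
open MvPolynomial

noncomputable section

/-- The specialization `δ ↦ 0`, `ε ↦ t` to the dual numbers (`t² = 0`) on the first factor agrees,
on the image of `φ`, with the specialization `g₂ ↦ 0`, `g₄ ↦ -(6/5)t`, `g₆ ↦ 0` on the second. -/
theorem aeval_fst_φ_eq_aeval_snd_φ (P : A) :
    aeval ![0, DualNumber.eps] (φ P).1 =
      aeval ![(0 : DualNumber ℚ), (-(6/5) : ℚ) • DualNumber.eps, 0] (φ P).2 := by
  suffices h : ((aeval ![(0 : DualNumber ℚ), DualNumber.eps]).comp (AlgHom.fst ℚ _ _)).comp φ =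
      ((aeval ![(0 : DualNumber ℚ), (-(6/5) : ℚ) • DualNumber.eps, 0]).comp
        (AlgHom.snd ℚ _ _)).comp φ from DFunLike.congr_fun h P
  refine algHom_ext fun i => ?_
  fin_cases i <;> simp [φ, pow_two, ← Algebra.smul_def, smul_smul]

/-- There is no polynomial `P ∈ ℚ[k, h₂, h₃, c]` with `φ(P) = (ε, 0)`:
`(ε, 0)` is not in the image of the product genus `φ_ell × φ_W`, even though
`(ε², 0)`, the image of the Cayley plane, is (the 'synergy' between the elliptic
genus and the Witten genus). -/
theorem stmt8 : ¬ ∃ P : A, φ P = ((X 1 : MvPolynomial (Fin 2) ℚ), 0) := by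
  rintro ⟨P, hP⟩
  have h := aeval_fst_φ_eq_aeval_snd_φ P
  rw [hP] at h
  simpa using congrArg TrivSqZeroExt.snd h

end
end

section
/- In ℚ[[q]] the identity G₈ = 120·G₄² holds, where Gₖ := −Bₖ/(2k) + Σ_{n≥1} σ_{k−1}(n) qⁿ and σ_{k−1}(n) = Σ_{d ∣ n} d^{k−1}. -/
open PowerSeries

noncomputable section

/-- The `q`-expansion `Gₖ ∈ ℚ[[q]]` of the Eisenstein series of weight `k` on the full
modular group: `Gₖ = −Bₖ/(2k) + Σ_{n≥1} σ_{k−1}(n) qⁿ`, where `Bₖ` is the `k`-th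
Bernoulli number and `σ_{k−1}(n) = Σ_{d ∣ n} d^{k−1}` is the divisor power sum. -/
def G (k : ℕ) : PowerSeries ℚ :=
  PowerSeries.mk fun n =>
    if n = 0 then -(bernoulli k) / (2 * k)
    else ∑ d ∈ n.divisors, (d : ℚ) ^ (k - 1)

open UpperHalfPlane ModularForm ModularFormClass MatrixGroups EisensteinSeries

/-- `Gₖ` is `-Bₖ/(2k)` times the `q`-expansion of the normalised Eisenstein series `Eₖ`. -/
lemma map_G_eq_smul_qExpansion_E {k : ℕ} (hk : 3 ≤ k) (hk2 : Even k) (hB : bernoulli k ≠ 0) :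
    (G k).map (algebraMap ℚ ℂ) = (-(bernoulli k) / (2 * k) : ℂ) • qExpansion 1 (E hk) := by
  ext n
  have hB' : (bernoulli k : ℂ) ≠ 0 := mod_cast hB
  have hk0 : (k : ℂ) ≠ 0 := by norm_cast; lia
  rw [coeff_map, coeff_smul, E_qExpansion_coeff hk hk2, G, coeff_mk]
  split_ifs
  · simp
  · simp only [ArithmeticFunction.sigma_apply, map_sum, map_pow, map_natCast, smul_eq_mul,
      Nat.cast_sum, Nat.cast_pow]
    field_simp

/-- The space of modular forms of level one and weight `8` is one-dimensional. -/
lemma ModularForm.levelOne_weight_eight_rank_one : Module.rank ℂ (ModularForm 𝒮ℒ 8) = 1 :=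
  (rank_eq_one_add_rank_cuspForm (k := 8) (by norm_num) ⟨4, rfl⟩).trans
    ((congrArg (1 + ·) (CuspForm.rank_eq_zero_of_weight_lt_twelve (by norm_num))).trans
      (by norm_cast))

/-- `E₈ = E₄²` on the level of `q`-expansions. -/
lemma qExpansion_E_eight_eq_sq :
    qExpansion 1 (E (k := 8) (by norm_num)) = qExpansion 1 (E (k := 4) (by norm_num)) ^ 2 := by
  have h8 : 3 ≤ 8 := by norm_num
  have h4 : 3 ≤ 4 := by norm_num
  obtain ⟨c, hc⟩ : ∃ c : ℂ, c • E h8 = (E h4).mul (E h4) :=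
    (finrank_eq_one_iff_of_nonzero' (E h8) (E_ne_zero h8 ⟨4, rfl⟩)).mp
      (Module.rank_eq_one_iff_finrank_eq_one.mp levelOne_weight_eight_rank_one) _
  have hq : c • qExpansion 1 (E h8) = qExpansion 1 (E h4) ^ 2 := by
    rw [pow_two, ← ModularForm.qExpansion_mul one_pos one_mem_strictPeriods_SL (E h4) (E h4),
      ← ModularForm.qExpansion_smul one_pos one_mem_strictPeriods_SL c (E h8),
      show (c • E h8 : ℍ → ℂ) = (E h4).mul (E h4) from congrArg DFunLike.coe hc]
  have hc1 : c = 1 := by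
    have h0 := congrArg (coeff 0) hq
    rwa [coeff_smul, E_qExpansion_coeff_zero h8 ⟨4, rfl⟩, smul_eq_mul, mul_one,
      coeff_zero_eq_constantCoeff_apply, map_pow, ← coeff_zero_eq_constantCoeff_apply,
      E_qExpansion_coeff_zero h4 ⟨2, rfl⟩, one_pow] at h0
  rwa [hc1, one_smul] at hq

/-- In `ℚ[[q]]` the identity `G₈ = 120·G₄²` holds. -/
theorem stmt14 : G 8 = 120 * (G 4) ^ 2 := by
  have hB4 : bernoulli 4 = -1 / 30 := by decide +kernel
  have hB8 : bernoulli 8 = -1 / 30 := by decide +kernel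
  apply PowerSeries.map_injective (algebraMap ℚ ℂ) (algebraMap ℚ ℂ).injective
  rw [map_mul, map_pow, map_ofNat,
    map_G_eq_smul_qExpansion_E (by norm_num) ⟨4, rfl⟩ (by norm_num [hB8]),
    map_G_eq_smul_qExpansion_E (by norm_num) ⟨2, rfl⟩ (by norm_num [hB4]),
    qExpansion_E_eight_eq_sq, hB4, hB8, smul_pow,
    show (120 : PowerSeries ℂ) = C (120 : ℂ) from (map_ofNat _ _).symm, ← smul_eq_C_mul, smul_smul]
  norm_num

end
end
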